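/- (Theorem 2, stationary solution.) Let K ≥ 1, and for each i ∈ {1,…,K} let F_i ∈ ℝ^{n×n}, H_i ∈ ℝ^{m×n}. Let Q ∈ ℝ^{n×n} and R ∈ ℝ^{m×m} be symmetric positive definite, let γ > 0, let x̂₀ ∈ ℝⁿ and measurements y₀,…,y_{N−1} ∈ ℝ^m be given. Suppose for each i there is a symmetric positive-definite P_i solving the algebraic Riccati equation P_i = Q + F_i P_i F_iᵀ − F_i P_i H_iᵀ (R + H_i P_i H_iᵀ)⁻¹ H_i P_i F_iᵀ with H_i P_i H_iᵀ ≺ γ² I. Define the stationary gain K_i = F_i P_i H_iᵀ (R + H_i P_i H_iᵀ)⁻¹, the filter x̆_{0,i} = x̂₀, x̆_{t+1,i} = F_i x̆_{t,i} + K_i (y_t − H_i x̆_{t,i}), and c_{0,i} = 0, c_{t+1,i} = c_{t,i} + |H_i x̆_{t,i} − y_t|²_{(R + H_i P_i H_iᵀ)⁻¹}. Then inf_{ŷ ∈ ℝ^m} sup over i and state trajectories x : {0,…,N} → ℝⁿ of [ |ŷ − H_i x_N|² − γ² ( |x₀ − x̂₀|²_{P_i⁻¹} + Σ_{t=0}^{N−1}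 ( |x_{t+1} − F_i x_t|²_{Q⁻¹} + |y_t − H_i x_t|²_{R⁻¹} ) ) ] equals inf_{ŷ ∈ ℝ^m} max_i [ |ŷ − H_i x̆_{N,i}|²_{(I − γ⁻² H_i P_i H_iᵀ)⁻¹} − γ² c_{N,i} ]. -/

import Mathlib

open Matrix

/-- Weighted squared norm `|z|²_M = zᵀ M z`. -/
noncomputable def qf {k : ℕ} (M : Matrix (Fin k) (Fin k) ℝ) (z : Fin k → ℝ) : ℝ :=
  z ⬝ᵥ M *ᵥ z

theorem qf_nonneg {k : ℕ} {M : Matrix (Fin k) (Fin k) ℝ} (hM : M.PosDef) (z : Fin k → ℝ) :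
    0 ≤ qf M z := by
  simpa [qf] using hM.posSemidef.dotProduct_mulVec_nonneg z

theorem qf_zero {k : ℕ} (M : Matrix (Fin k) (Fin k) ℝ) : qf M 0 = 0 := by
  simp [qf]

theorem qf_neg {k : ℕ} (M : Matrix (Fin k) (Fin k) ℝ) (z : Fin k → ℝ) :
    qf M (-z) = qf M z := by
  simp [qf, mulVec_neg]

theorem qf_smul_matrix {k : ℕ} (r : ℝ) (M : Matrix (Fin k) (Fin k) ℝ) (z : Fin k → ℝ) :
    qf (r • M) z = r * qf M z := by
  simp [qf, smul_mulVec]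

theorem qf_one {k : ℕ} (z : Fin k → ℝ) : qf (1 : Matrix (Fin k) (Fin k) ℝ) z = z ⬝ᵥ z := by
  simp [qf]

theorem qf_add_vec {k : ℕ} {M : Matrix (Fin k) (Fin k) ℝ} (hM : Mᵀ = M) (a b : Fin k → ℝ) :
    qf M (a + b) = qf M a + qf M b + 2 * (b ⬝ᵥ M *ᵥ a) := by
  have h : a ⬝ᵥ M *ᵥ b = b ⬝ᵥ M *ᵥ a := by
    rw [dotProduct_mulVec, ← mulVec_transpose, hM, dotProduct_comm]
  simp only [qf, mulVec_add, add_dotProduct, dotProduct_add, h]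
  ring

theorem qf_transpose_mul_mul {k l : ℕ} (B : Matrix (Fin l) (Fin l) ℝ)
    (L : Matrix (Fin l) (Fin k) ℝ) (z : Fin k → ℝ) : qf (Lᵀ * B * L) z = qf B (L *ᵥ z) := by
  rw [qf, qf, ← mulVec_mulVec, ← mulVec_mulVec, dotProduct_mulVec, vecMul_transpose]

theorem qf_add_matrix {k : ℕ} (M M' : Matrix (Fin k) (Fin k) ℝ) (z : Fin k → ℝ) :
    qf (M + M') z = qf M z + qf M' z := by
  simp [qf, add_mulVec]

theorem isUnit_det_of_posDef {k : ℕ} {M : Matrix (Fin k) (Fin k) ℝ} (hM : M.PosDef) :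
    IsUnit M.det := (isUnit_iff_isUnit_det M).1 hM.isUnit

theorem transpose_eq_of_posDef {k : ℕ} {M : Matrix (Fin k) (Fin k) ℝ} (hM : M.PosDef) :
    Mᵀ = M := by
  simpa [IsHermitian] using hM.isHermitian

theorem inv_smul_of_ne_zero {k : ℕ} {r : ℝ} (hr : r ≠ 0) {M : Matrix (Fin k) (Fin k) ℝ}
    (hM : IsUnit M.det) : (r • M)⁻¹ = r⁻¹ • M⁻¹ := by
  refine inv_eq_right_inv ?_
  rw [smul_mul_smul_comm, mul_nonsing_inv _ hM, mul_inv_cancel₀ hr, one_smul]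

theorem isUnit_det_smul {k : ℕ} {r : ℝ} (hr : r ≠ 0) {M : Matrix (Fin k) (Fin k) ℝ}
    (hM : IsUnit M.det) : IsUnit (r • M).det := by
  rw [det_smul]
  exact ((isUnit_iff_ne_zero.2 hr).pow _).mul hM

/-- Completion of the square in a regularized least-squares problem. -/
theorem qf_inv_add_qf_inv_sub {k l : ℕ} {A : Matrix (Fin k) (Fin k) ℝ}
    {B T : Matrix (Fin l) (Fin l) ℝ} {L : Matrix (Fin l) (Fin k) ℝ}
    (hA : Aᵀ = A) (hB : Bᵀ = B) (hA' : IsUnit A.det) (hB' : IsUnit B.det) (hT' : IsUnit T.det)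
    (hT : T = B + L * A * Lᵀ) (e : Fin k → ℝ) (u : Fin l → ℝ) :
    qf A⁻¹ e + qf B⁻¹ (u - L *ᵥ e) =
      qf T⁻¹ u + qf (A⁻¹ + Lᵀ * B⁻¹ * L) (e - (A * Lᵀ * T⁻¹) *ᵥ u) := by
  obtain ⟨w, rfl⟩ : ∃ w, u = T *ᵥ w := ⟨T⁻¹ *ᵥ u, by simp [mul_nonsing_inv _ hT']⟩
  obtain ⟨d, rfl⟩ : ∃ d, e = (A * Lᵀ) *ᵥ w + d := ⟨e - (A * Lᵀ) *ᵥ w, by simp⟩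
  have hTT : Tᵀ = T := by simp [hT, hA, hB, Matrix.mul_assoc]
  have hAi : (A⁻¹)ᵀ = A⁻¹ := by rw [transpose_nonsing_inv, hA]
  have hBi : (B⁻¹)ᵀ = B⁻¹ := by rw [transpose_nonsing_inv, hB]
  have h1 : T *ᵥ w - L *ᵥ ((A * Lᵀ) *ᵥ w + d) = B *ᵥ w + -(L *ᵥ d) := by
    simp only [hT, add_mulVec, mulVec_add, mulVec_mulVec, Matrix.mul_assoc]
    abel
  have h2 : (A * Lᵀ) *ᵥ w + d - (A * Lᵀ * T⁻¹) *ᵥ (T *ᵥ w) = d := by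
    rw [mulVec_mulVec, Matrix.mul_assoc (A * Lᵀ), nonsing_inv_mul _ hT', Matrix.mul_one]
    abel
  have h3 : qf T⁻¹ (T *ᵥ w) = qf T w := by
    rw [← qf_transpose_mul_mul, hTT, mul_nonsing_inv _ hT', Matrix.one_mul]
  have h4 : qf B⁻¹ (B *ᵥ w) = qf B w := by
    rw [← qf_transpose_mul_mul, hB, mul_nonsing_inv _ hB', Matrix.one_mul]
  have h5 : qf A⁻¹ ((A * Lᵀ) *ᵥ w) = qf (L * A * Lᵀ) w := by
    rw [← qf_transpose_mul_mul, transpose_mul, hA, transpose_transpose, Matrix.mul_assoc (L * A),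
      ← Matrix.mul_assoc A⁻¹, nonsing_inv_mul _ hA', Matrix.one_mul]
  have h6 : A⁻¹ *ᵥ ((A * Lᵀ) *ᵥ w) = Lᵀ *ᵥ w := by
    rw [mulVec_mulVec, ← Matrix.mul_assoc, nonsing_inv_mul _ hA', Matrix.one_mul]
  have h7 : B⁻¹ *ᵥ (B *ᵥ w) = w := by
    rw [mulVec_mulVec, nonsing_inv_mul _ hB', one_mulVec]
  have h8 : L *ᵥ d ⬝ᵥ w = d ⬝ᵥ Lᵀ *ᵥ w := by
    rw [dotProduct_mulVec, vecMul_transpose]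
  have h9 : qf T w = qf B w + qf (L * A * Lᵀ) w := by rw [hT, qf_add_matrix]
  rw [h1, h2, h3, qf_add_vec hAi, qf_add_vec hBi, h4, h5, h6, h7, qf_neg, neg_dotProduct, h8,
    qf_add_matrix, qf_transpose_mul_mul, h9]
  ring

theorem posDef_add_mul_mul_transpose {k l : ℕ} {A : Matrix (Fin k) (Fin k) ℝ}
    {B : Matrix (Fin l) (Fin l) ℝ} (hA : A.PosDef) (hB : B.PosDef)
    (L : Matrix (Fin l) (Fin k) ℝ) : (B + L * A * Lᵀ).PosDef := by
  have h := hB.add_posSemidef (hA.posSemidef.mul_mul_conjTranspose_same L)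
  rwa [conjTranspose_eq_transpose_of_trivial] at h

theorem posDef_inv_add_transpose_mul_inv_mul {k l : ℕ} {A : Matrix (Fin k) (Fin k) ℝ}
    {B : Matrix (Fin l) (Fin l) ℝ} (hA : A.PosDef) (hB : B.PosDef)
    (L : Matrix (Fin l) (Fin k) ℝ) : (A⁻¹ + Lᵀ * B⁻¹ * L).PosDef := by
  simpa using posDef_add_mul_mul_transpose hB.inv hA.inv Lᵀ

/-- One step of the Kalman filter as completion of squares. -/
theorem qf_kalman_step {n m : ℕ} {F Q P : Matrix (Fin n) (Fin n) ℝ}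
    {H : Matrix (Fin m) (Fin n) ℝ} {R : Matrix (Fin m) (Fin m) ℝ}
    (hQ : Q.PosDef) (hR : R.PosDef) (hP : P.PosDef)
    (hARE : P = Q + F * P * Fᵀ - F * P * Hᵀ * (R + H * P * Hᵀ)⁻¹ * (H * P * Fᵀ))
    (xb z : Fin n → ℝ) (v : Fin m → ℝ) :
    ∃ (M : Matrix (Fin n) (Fin n) ℝ) (s : Fin n → ℝ), M.PosDef ∧ ∀ x : Fin n → ℝ,
      qf P⁻¹ (x - xb) + (qf Q⁻¹ (z - F *ᵥ x) + qf R⁻¹ (v - H *ᵥ x)) =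
        qf P⁻¹ (z - (F *ᵥ xb + (F * P * Hᵀ * (R + H * P * Hᵀ)⁻¹) *ᵥ (v - H *ᵥ xb))) +
          qf (R + H * P * Hᵀ)⁻¹ (H *ᵥ xb - v) + qf M (x - s) := by
  have hT := posDef_add_mul_mul_transpose hP hR H
  have hI := posDef_inv_add_transpose_mul_inv_mul hP hR H
  have hS := hI.inv
  have hW : (P⁻¹ + Hᵀ * R⁻¹ * H)⁻¹ = P - P * Hᵀ * (R + H * P * Hᵀ)⁻¹ * H * P := by
    have h := add_mul_mul_inv_eq_sub P⁻¹ Hᵀ R⁻¹ H hP.inv.isUnit hR.inv.isUnit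
      (by simpa [nonsing_inv_nonsing_inv _ (isUnit_det_of_posDef hP),
        nonsing_inv_nonsing_inv _ (isUnit_det_of_posDef hR)] using hT.isUnit)
    simpa [nonsing_inv_nonsing_inv _ (isUnit_det_of_posDef hP),
        nonsing_inv_nonsing_inv _ (isUnit_det_of_posDef hR)] using h
  have hPS : P = Q + F * (P⁻¹ + Hᵀ * R⁻¹ * H)⁻¹ * Fᵀ := by
    rw [hW]
    conv_lhs => rw [hARE]
    simp only [Matrix.mul_sub, Matrix.sub_mul, Matrix.mul_assoc, add_sub_assoc]
  set S := (P⁻¹ + Hᵀ * R⁻¹ * H)⁻¹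
  set G := P * Hᵀ * (R + H * P * Hᵀ)⁻¹ with hG
  have hSi : P⁻¹ + Hᵀ * R⁻¹ * H = S⁻¹ :=
    (nonsing_inv_nonsing_inv _ (isUnit_det_of_posDef hI)).symm
  have hFG : F * P * Hᵀ * (R + H * P * Hᵀ)⁻¹ = F * G := by simp only [hG, Matrix.mul_assoc]
  refine ⟨S⁻¹ + Fᵀ * Q⁻¹ * F, xb + G *ᵥ (v - H *ᵥ xb) + (S * Fᵀ * P⁻¹) *ᵥ
    (z - (F *ᵥ xb + (F * G) *ᵥ (v - H *ᵥ xb))),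
    posDef_inv_add_transpose_mul_inv_mul hS hQ F, fun x => ?_⟩
  have e1 := qf_inv_add_qf_inv_sub (transpose_eq_of_posDef hP) (transpose_eq_of_posDef hR)
    (isUnit_det_of_posDef hP) (isUnit_det_of_posDef hR) (isUnit_det_of_posDef hT) rfl
    (x - xb) (v - H *ᵥ xb)
  have e2 := qf_inv_add_qf_inv_sub (transpose_eq_of_posDef hS) (transpose_eq_of_posDef hQ)
    (isUnit_det_of_posDef hS) (isUnit_det_of_posDef hQ) (isUnit_det_of_posDef hP) hPS
    (x - xb - G *ᵥ (v - H *ᵥ xb)) (z - (F *ᵥ xb + (F * G) *ᵥ (v - H *ᵥ xb)))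
  rw [← hG, hSi] at e1
  have a1 : v - H *ᵥ xb - H *ᵥ (x - xb) = v - H *ᵥ x := by rw [mulVec_sub]; abel
  have a2 : z - (F *ᵥ xb + (F * G) *ᵥ (v - H *ᵥ xb)) - F *ᵥ (x - xb - G *ᵥ (v - H *ᵥ xb)) =
      z - F *ᵥ x := by
    rw [mulVec_sub F (x - xb), mulVec_sub F x, mulVec_mulVec]; abel
  rw [a1] at e1
  rw [a2] at e2
  rw [hFG, ← neg_sub v, qf_neg, add_assoc xb, ← sub_sub x, ← sub_sub (x - xb)]
  linarith

/-- The forward value function of the estimation problem. -/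
theorem kalman_cost {n m : ℕ} {F Q P : Matrix (Fin n) (Fin n) ℝ}
    {H : Matrix (Fin m) (Fin n) ℝ} {R : Matrix (Fin m) (Fin m) ℝ}
    (hQ : Q.PosDef) (hR : R.PosDef) (hP : P.PosDef)
    (hARE : P = Q + F * P * Fᵀ - F * P * Hᵀ * (R + H * P * Hᵀ)⁻¹ * (H * P * Fᵀ))
    {xb : ℕ → Fin n → ℝ} {c : ℕ → ℝ} {y : ℕ → Fin m → ℝ}
    (hxrec : ∀ t, xb (t + 1) =
      F *ᵥ xb t + (F * P * Hᵀ * (R + H * P * Hᵀ)⁻¹) *ᵥ (y t - H *ᵥ xb t))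
    (hc0 : c 0 = 0)
    (hcrec : ∀ t, c (t + 1) = c t + qf (R + H * P * Hᵀ)⁻¹ (H *ᵥ xb t - y t)) (N : ℕ) :
    (∀ x : ℕ → Fin n → ℝ, qf P⁻¹ (x N - xb N) + c N ≤ qf P⁻¹ (x 0 - xb 0) +
        ∑ t ∈ Finset.range N, (qf Q⁻¹ (x (t + 1) - F *ᵥ x t) + qf R⁻¹ (y t - H *ᵥ x t))) ∧
      ∀ z : Fin n → ℝ, ∃ x : ℕ → Fin n → ℝ, x N = z ∧
        qf P⁻¹ (x 0 - xb 0) +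
          ∑ t ∈ Finset.range N, (qf Q⁻¹ (x (t + 1) - F *ᵥ x t) + qf R⁻¹ (y t - H *ᵥ x t)) =
        qf P⁻¹ (z - xb N) + c N := by
  induction N with
  | zero => exact ⟨fun x => by simp [hc0], fun z => ⟨fun _ => z, rfl, by simp [hc0]⟩⟩
  | succ N ih =>
    obtain ⟨ih1, ih2⟩ := ih
    refine ⟨fun x => ?_, fun z => ?_⟩
    · obtain ⟨M, s, hM, h⟩ := qf_kalman_step hQ hR hP hARE (xb N) (x (N + 1)) (y N)
      have h := h (x N)
      have h0 := qf_nonneg hM (x N - s)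
      have h1 := ih1 x
      rw [Finset.sum_range_succ, hxrec, hcrec]
      linarith
    · obtain ⟨M, s, hM, h⟩ := qf_kalman_step hQ hR hP hARE (xb N) z (y N)
      obtain ⟨x, hx, hxe⟩ := ih2 s
      have h := h s
      rw [sub_self, qf_zero] at h
      have hne : ∀ t ≤ N, Function.update x (N + 1) z t = x t := fun t ht =>
        Function.update_of_ne (by omega) _ _
      refine ⟨Function.update x (N + 1) z, Function.update_self .., ?_⟩
      have hsum : ∑ t ∈ Finset.range N, (qf Q⁻¹ (Function.update x (N + 1) z (t + 1) -
            F *ᵥ Function.update x (N + 1) z t) +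
            qf R⁻¹ (y t - H *ᵥ Function.update x (N + 1) z t)) =
          ∑ t ∈ Finset.range N, (qf Q⁻¹ (x (t + 1) - F *ᵥ x t) + qf R⁻¹ (y t - H *ᵥ x t)) := by
        refine Finset.sum_congr rfl fun t ht => ?_
        have := Finset.mem_range.1 ht
        rw [hne t (by omega), hne (t + 1) (by omega)]
      rw [Finset.sum_range_succ, hsum, hne 0 (by omega), hne N le_rfl, Function.update_self, hx,
        hxrec, hcrec]
      linarith

/-- Maximization of the estimation error over the terminal state. -/
theorem terminal_completion {n m : ℕ} {P : Matrix (Fin n) (Fin n) ℝ}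
    {H : Matrix (Fin m) (Fin n) ℝ} {γ : ℝ} (hγ : 0 < γ) (hP : P.PosDef)
    (hgam : (γ ^ 2 • (1 : Matrix (Fin m) (Fin m) ℝ) - H * P * Hᵀ).PosDef)
    (xb : Fin n → ℝ) (yh : Fin m → ℝ) :
    (∀ z, (yh - H *ᵥ z) ⬝ᵥ (yh - H *ᵥ z) - γ ^ 2 * qf P⁻¹ (z - xb) ≤
      qf ((1 : Matrix (Fin m) (Fin m) ℝ) - (γ ^ 2)⁻¹ • (H * P * Hᵀ))⁻¹ (yh - H *ᵥ xb)) ∧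
    ∃ z, (yh - H *ᵥ z) ⬝ᵥ (yh - H *ᵥ z) - γ ^ 2 * qf P⁻¹ (z - xb) =
      qf ((1 : Matrix (Fin m) (Fin m) ℝ) - (γ ^ 2)⁻¹ • (H * P * Hᵀ))⁻¹ (yh - H *ᵥ xb) := by
  have hg : (γ ^ 2 : ℝ) ≠ 0 := by positivity
  have h1 : IsUnit (1 : Matrix (Fin m) (Fin m) ℝ).det := by simp
  have hG := isUnit_det_of_posDef hgam
  have hng : (-(γ ^ 2) : ℝ) ≠ 0 := neg_ne_zero.2 hg
  have hT : (-1 : ℝ) • (γ ^ 2 • (1 : Matrix (Fin m) (Fin m) ℝ) - H * P * Hᵀ) =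
      (-(γ ^ 2)) • (1 : Matrix (Fin m) (Fin m) ℝ) + H * P * Hᵀ := by
    simp only [smul_sub, neg_smul, one_smul]; abel
  have hTr : (1 : Matrix (Fin m) (Fin m) ℝ) - (γ ^ 2)⁻¹ • (H * P * Hᵀ) =
      (γ ^ 2)⁻¹ • (γ ^ 2 • (1 : Matrix (Fin m) (Fin m) ℝ) - H * P * Hᵀ) := by
    rw [smul_sub, smul_smul, inv_mul_cancel₀ hg, one_smul]
  have key : ∀ z, (yh - H *ᵥ z) ⬝ᵥ (yh - H *ᵥ z) - γ ^ 2 * qf P⁻¹ (z - xb) =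
      qf ((1 : Matrix (Fin m) (Fin m) ℝ) - (γ ^ 2)⁻¹ • (H * P * Hᵀ))⁻¹ (yh - H *ᵥ xb) -
      γ ^ 2 * qf (P⁻¹ + Hᵀ * ((-(γ ^ 2)) • (1 : Matrix (Fin m) (Fin m) ℝ))⁻¹ * H)
        (z - xb - (P * Hᵀ * ((-1 : ℝ) •
          (γ ^ 2 • (1 : Matrix (Fin m) (Fin m) ℝ) - H * P * Hᵀ))⁻¹) *ᵥ (yh - H *ᵥ xb)) := by
    intro z
    have e := qf_inv_add_qf_inv_sub (transpose_eq_of_posDef hP)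
      (B := (-(γ ^ 2)) • (1 : Matrix (Fin m) (Fin m) ℝ)) (by simp)
      (isUnit_det_of_posDef hP) (isUnit_det_smul hng h1) (isUnit_det_smul (by norm_num) hG) hT (z - xb)
      (yh - H *ᵥ xb)
    have a1 : yh - H *ᵥ xb - H *ᵥ (z - xb) = yh - H *ᵥ z := by rw [mulVec_sub]; abel
    generalize qf (P⁻¹ + Hᵀ * ((-(γ ^ 2)) • (1 : Matrix (Fin m) (Fin m) ℝ))⁻¹ * H) _ = rem at e ⊢
    rw [a1, inv_smul_of_ne_zero hng h1, inv_smul_of_ne_zero (by norm_num) hG, inv_one, qf_smul_matrix, qf_smul_matrix,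
      qf_one] at e
    rw [hTr, inv_smul_of_ne_zero (inv_ne_zero hg) hG, qf_smul_matrix, inv_inv]
    generalize (yh - H *ᵥ z) ⬝ᵥ (yh - H *ᵥ z) = d at e ⊢
    have e' := congrArg (fun r => -(γ ^ 2) * r) e
    simp only [mul_add, ← mul_assoc, mul_inv_cancel₀ hng] at e'
    norm_num at e'
    linarith
  have hrem : ∀ d, 0 ≤ qf (P⁻¹ + Hᵀ * ((-(γ ^ 2)) • (1 : Matrix (Fin m) (Fin m) ℝ))⁻¹ * H) d := by
    intro d
    have e := qf_inv_add_qf_inv_sub (transpose_eq_of_posDef hP) (transpose_eq_of_posDef hgam)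
      (isUnit_det_of_posDef hP) hG (isUnit_det_smul hg h1) (sub_add_cancel _ _).symm d (H *ᵥ d)
    have h0 := qf_nonneg (posDef_inv_add_transpose_mul_inv_mul hP hgam H)
      (d - (P * Hᵀ * (γ ^ 2 • (1 : Matrix (Fin m) (Fin m) ℝ))⁻¹) *ᵥ (H *ᵥ d))
    rw [sub_self, qf_zero, inv_smul_of_ne_zero hg h1, inv_one, qf_smul_matrix] at e
    rw [inv_smul_of_ne_zero hg h1, inv_one] at h0
    rw [qf_add_matrix, qf_transpose_mul_mul, inv_smul_of_ne_zero hng h1, inv_one, qf_smul_matrix, inv_neg]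
    linarith
  refine ⟨fun z => ?_, ⟨xb + (P * Hᵀ * ((-1 : ℝ) •
    (γ ^ 2 • (1 : Matrix (Fin m) (Fin m) ℝ) - H * P * Hᵀ))⁻¹) *ᵥ (yh - H *ᵥ xb), ?_⟩⟩
  · rw [key z]
    have := mul_nonneg (sq_nonneg γ) (hrem (z - xb - (P * Hᵀ * ((-1 : ℝ) •
      (γ ^ 2 • (1 : Matrix (Fin m) (Fin m) ℝ) - H * P * Hᵀ))⁻¹) *ᵥ (yh - H *ᵥ xb)))
    linarith
  · rw [key, add_sub_cancel_left, sub_self, qf_zero, mul_zero, sub_zero]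

/-- (Theorem 2, stationary solution.) If for each model `i` there is a symmetric
positive-definite `P_i` solving the algebraic Riccati equation with
`H_i P_i H_iᵀ ≺ γ² I`, then the game value
`inf_ŷ sup_{i, x(·)} [ |ŷ − H_i x_N|² − γ² ( |x₀ − x̂₀|²_{P_i⁻¹}
  + Σ_t (|x_{t+1} − F_i x_t|²_{Q⁻¹} + |y_t − H_i x_t|²_{R⁻¹}) ) ]`
equals
`inf_ŷ max_i [ |ŷ − H_i x̆_{N,i}|²_{(I − γ⁻² H_i P_i H_iᵀ)⁻¹} − γ² c_{N,i} ]`,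
with the stationary Kalman filter recursions. -/
theorem minimax_stationary_solution {n m N K : ℕ} (hK : 1 ≤ K)
    (F : Fin K → Matrix (Fin n) (Fin n) ℝ) (H : Fin K → Matrix (Fin m) (Fin n) ℝ)
    (Q : Matrix (Fin n) (Fin n) ℝ) (R : Matrix (Fin m) (Fin m) ℝ)
    (hQ : Q.PosDef) (hR : R.PosDef)
    (γ : ℝ) (hγ : 0 < γ)
    (xh₀ : Fin n → ℝ) (y : ℕ → Fin m → ℝ)
    (P : Fin K → Matrix (Fin n) (Fin n) ℝ)
    (hPpos : ∀ i, (P i).PosDef)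
    (hARE : ∀ i, P i =
      Q + F i * P i * (F i)ᵀ -
        F i * P i * (H i)ᵀ * (R + H i * P i * (H i)ᵀ)⁻¹ * (H i * P i * (F i)ᵀ))
    (hgam : ∀ i, (γ ^ 2 • (1 : Matrix (Fin m) (Fin m) ℝ) - H i * P i * (H i)ᵀ).PosDef)
    (Kg : Fin K → Matrix (Fin n) (Fin m) ℝ)
    (hKg : ∀ i, Kg i = F i * P i * (H i)ᵀ * (R + H i * P i * (H i)ᵀ)⁻¹)
    (xbr : Fin K → ℕ → Fin n → ℝ) (c : Fin K → ℕ → ℝ)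
    (hx0 : ∀ i, xbr i 0 = xh₀)
    (hxrec : ∀ i t, xbr i (t + 1) = F i *ᵥ xbr i t + Kg i *ᵥ (y t - H i *ᵥ xbr i t))
    (hc0 : ∀ i, c i 0 = 0)
    (hcrec : ∀ i t, c i (t + 1) =
      c i t + qf (R + H i * P i * (H i)ᵀ)⁻¹ (H i *ᵥ xbr i t - y t)) :
    (⨅ yh : Fin m → ℝ, ⨆ p : Fin K × (ℕ → Fin n → ℝ),
        (yh - H p.1 *ᵥ p.2 N) ⬝ᵥ (yh - H p.1 *ᵥ p.2 N) -
          γ ^ 2 * (qf (P p.1)⁻¹ (p.2 0 - xh₀) +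
            ∑ t ∈ Finset.range N,
              (qf Q⁻¹ (p.2 (t + 1) - F p.1 *ᵥ p.2 t) + qf R⁻¹ (y t - H p.1 *ᵥ p.2 t)))) =
      ⨅ yh : Fin m → ℝ, ⨆ i : Fin K,
        (qf ((1 : Matrix (Fin m) (Fin m) ℝ) - (γ ^ 2)⁻¹ • (H i * P i * (H i)ᵀ))⁻¹
            (yh - H i *ᵥ xbr i N) -
          γ ^ 2 * c i N) := by
  have : Nonempty (Fin K) := ⟨⟨0, hK⟩⟩
  have hcost := fun i => kalman_cost hQ hR (hPpos i) (hARE i) (xb := xbr i) (c := c i) (y := y)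
    (fun t => by rw [hxrec, hKg]) (hc0 i) (hcrec i) N
  simp only [hx0] at hcost
  refine congrArg _ (funext fun yh => ?_)
  have hterm := fun i => terminal_completion hγ (hPpos i) (hgam i) (xbr i N) yh
  have hle : ∀ p : Fin K × (ℕ → Fin n → ℝ),
      (yh - H p.1 *ᵥ p.2 N) ⬝ᵥ (yh - H p.1 *ᵥ p.2 N) -
          γ ^ 2 * (qf (P p.1)⁻¹ (p.2 0 - xh₀) +
            ∑ t ∈ Finset.range N,
              (qf Q⁻¹ (p.2 (t + 1) - F p.1 *ᵥ p.2 t) + qf R⁻¹ (y t - H p.1 *ᵥ p.2 t))) ≤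
      ⨆ i : Fin K,
        (qf ((1 : Matrix (Fin m) (Fin m) ℝ) - (γ ^ 2)⁻¹ • (H i * P i * (H i)ᵀ))⁻¹
            (yh - H i *ᵥ xbr i N) - γ ^ 2 * c i N) := by
    rintro ⟨i, x⟩
    refine le_trans ?_ (le_ciSup (Set.finite_range _).bddAbove i)
    have h1 := mul_le_mul_of_nonneg_left ((hcost i).1 x) (sq_nonneg γ)
    have h2 := (hterm i).1 (x N)
    rw [mul_add] at h1
    dsimp only
    linarith
  refine le_antisymm (ciSup_le hle) (ciSup_le fun i => ?_)
  obtain ⟨z, hz⟩ := (hterm i).2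
  obtain ⟨x, hxN, hx⟩ := (hcost i).2 z
  refine le_trans (le_of_eq ?_)
    (le_ciSup ⟨_, Set.forall_mem_range.2 hle⟩ ((i, x) : Fin K × (ℕ → Fin n → ℝ)))
  dsimp only
  rw [hx, hxN, ← hz]
  ring
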